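/- arXiv:1003.6016 — 3 statements merged into one kernel-verified Lean document; each statement's English description precedes it below -/
import Mathlib

section
/- Let d ≥ 3. There exists ε > 0 depending only on d such that the following holds. Let P u = Σ_{j,k} a_{jk}(x) D_j D_k u + Σ_k b_k(x) D_k u with smooth coefficients a_{jk}, b_k all of whose derivatives are bounded, assume P is symmetric, and assume Σ_{j,k} (‖a_{jk} − δ_{jk}‖_{L^∞} + Σ_l ‖∂_l a_{jk}‖_{L^d}) + Σ_k ‖b_k‖_{L^d} < ε, where δ_{jk} is the Kronecker symbol. Then for every Schwartz function u: (i) ⟨Pu, u⟩ is real and (1/2) ‖∇u‖_{L²}² ≤ ⟨Pu, u⟩ ≤ 2 ‖∇u‖_{L²}², and (ii) (1/2) ‖Δu‖_{L²} ≤ ‖Pu‖_{L²} ≤ 2 ‖Δu‖_{L²}. In particular ⟨Pu,u⟩ ≥ 0 for all Schwartz u. -/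
open MeasureTheory Complex Finset
open scoped ENNReal

noncomputable section

abbrev Euc (d : ℕ) := EuclideanSpace ℝ (Fin d)

/-- Partial derivative `∂_j` of a complex-valued function on `ℝ^d`. -/
def pd {d : ℕ} (j : Fin d) (u : Euc d → ℂ) : Euc d → ℂ :=
  fun x => fderiv ℝ u x (EuclideanSpace.single j 1)

/-- Iterated partial derivative `∂^α` for a multi-index `α`. -/
def pdAlpha {d : ℕ} (α : Fin d → ℕ) (u : Euc d → ℂ) : Euc d → ℂ :=
  (List.finRange d).foldr (fun j v => (pd j)^[α j] v) u

/-- The Laplacian `Δ = Σ_j ∂_j²`. -/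
def lap {d : ℕ} (u : Euc d → ℂ) : Euc d → ℂ :=
  fun x => ∑ j, pd j (pd j u) x

/-- The operator `x·∇`. -/
def xGrad {d : ℕ} (u : Euc d → ℂ) : Euc d → ℂ :=
  fun x => ∑ j, (x j : ℂ) * pd j u x

/-- Multi-indices `α` on `Fin d` with `|α| ≤ r`. -/
def multiIndices (d r : ℕ) : Finset (Fin d → ℕ) :=
  (Fintype.piFinset fun _ : Fin d => Finset.range (r + 1)).filter
    (fun α => ∑ i, α i ≤ r)

/-- The norm `‖a‖_{o,r,N} = Σ_{n ≤ N, |α| ≤ r} ‖∂^α (x·∇)^n a‖_{L^{d/(o+|α|)}}`,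
with the convention `L^{d/0} = L^∞` (in `ℝ≥0∞`, `d/0 = ∞`). -/
def coefNorm (d o r N : ℕ) (a : Euc d → ℂ) : ℝ≥0∞ :=
  ∑ n ∈ Finset.range (N + 1), ∑ α ∈ multiIndices d r,
    eLpNorm (pdAlpha α ((xGrad (d := d))^[n] a))
      ((d : ℝ≥0∞) / ((o + ∑ i, α i : ℕ) : ℝ≥0∞)) volume

/-- The Sobolev norm `‖v‖_{H^m} = Σ_{|α| ≤ m} ‖∂^α v‖_{L²}`. -/
def sobNorm (d s : ℕ) (u : Euc d → ℂ) : ℝ≥0∞ :=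
  ∑ α ∈ multiIndices d s, eLpNorm (pdAlpha α u) 2 volume

/-- `D_j = -i ∂_j`. -/
def Dop {d : ℕ} (j : Fin d) (u : Euc d → ℂ) : Euc d → ℂ :=
  fun x => -Complex.I * pd j u x

/-- The operator `P u = Σ_{j,k} a_{jk} D_j D_k u + Σ_k b_k D_k u`. -/
def Pop {d : ℕ} (a : Fin d → Fin d → Euc d → ℂ) (b : Fin d → Euc d → ℂ)
    (u : Euc d → ℂ) : Euc d → ℂ :=
  fun x => (∑ j, ∑ k, a j k x * Dop j (Dop k u) x) + ∑ k, b k x * Dop k u x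

/-- The generator of dilations `A = (x·∇)/i + d/2`. -/
def Aop {d : ℕ} (u : Euc d → ℂ) : Euc d → ℂ :=
  fun x => -Complex.I * xGrad u x + ((d : ℂ) / 2) * u x

/-- Iterated commutators `ad_A^0 T = T`, `ad_A^{n+1} T = (ad_A^n T) A - A (ad_A^n T)`. -/
def adA {d : ℕ} : ℕ → ((Euc d → ℂ) → (Euc d → ℂ)) → ((Euc d → ℂ) → (Euc d → ℂ))
  | 0, T => T
  | n + 1, T => fun u x => adA n T (Aop u) x - Aop (adA n T u) x

/-- `P` is symmetric on Schwartz functions. -/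
def IsSymmP {d : ℕ} (a : Fin d → Fin d → Euc d → ℂ) (b : Fin d → Euc d → ℂ) : Prop :=
  ∀ u v : SchwartzMap (Euc d) ℂ,
    ∫ x, Pop a b u x * (starRingEnd ℂ) (v x) = ∫ x, u x * (starRingEnd ℂ) (Pop a b v x)

/-- Smooth with all derivatives bounded. -/
def CinftyBdd {d : ℕ} (f : Euc d → ℂ) : Prop :=
  ContDiff ℝ (⊤ : ℕ∞) f ∧ ∀ n : ℕ, ∃ C : ℝ, ∀ x, ‖iteratedFDeriv ℝ n f x‖ ≤ C

/-- `r̄(d)`: the largest integer strictly smaller than `d/2`. -/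
def rbar (d : ℕ) : ℕ := (d - 1) / 2

/-- `‖∇u‖_{L²} = (Σ_j ‖∂_j u‖_{L²}²)^{1/2}`. -/
def gradNorm {d : ℕ} (u : Euc d → ℂ) : ℝ≥0∞ :=
  (∑ j, eLpNorm (pd j u) 2 volume ^ 2) ^ (1 / 2 : ℝ)

/-- `‖∇u‖_{L²}²` as a real number, for Schwartz `u`. -/
def gradSq {d : ℕ} (u : Euc d → ℂ) : ℝ :=
  ∑ j, ∫ x, ‖pd j u x‖ ^ 2

/-- Japanese bracket `⟨x⟩ = (1+|x|²)^{1/2}`. -/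
def jap {d : ℕ} (x : Euc d) : ℝ := Real.sqrt (1 + ‖x‖ ^ 2)


/-- The partial derivative as a map of the Schwartz space. -/
def schwartzPd {d : ℕ} (j : Fin d) (u : SchwartzMap (Euc d) ℂ) : SchwartzMap (Euc d) ℂ :=
  LineDeriv.lineDerivOp (EuclideanSpace.single j (1 : ℝ) : Euc d) u

lemma coe_schwartzPd {d : ℕ} (j : Fin d) (u : SchwartzMap (Euc d) ℂ) :
    ⇑(schwartzPd j u) = pd j ⇑u := rfl

lemma schwartzPd_comm {d : ℕ} (j k : Fin d) (u : SchwartzMap (Euc d) ℂ) :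
    schwartzPd j (schwartzPd k u) = schwartzPd k (schwartzPd j u) := by
  have h2 : ∀ (v w : Euc d) (x : Euc d),
      fderiv ℝ (fun y => fderiv ℝ ⇑u y v) x w = fderiv ℝ (fderiv ℝ ⇑u) x w v := by
    intro v w x
    have hd : DifferentiableAt ℝ (fderiv ℝ ⇑u) x :=
      ((u.smooth 2).fderiv_right (m := 1) (by norm_num)).differentiable one_ne_zero x
    rw [fderiv_clm_apply hd (differentiableAt_const v)]
    simp
  ext x
  simp only [coe_schwartzPd, pd]
  refine (h2 _ _ x).trans (Eq.trans ?_ (h2 _ _ x).symm)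
  exact ((u.smooth 2).contDiffAt.isSymmSndFDerivAt (by simp)) _ _

/-- The sesquilinear form `(z, w) ↦ z * conj w` as a real bilinear map. -/
def mulConj : ℂ →L[ℝ] ℂ →L[ℝ] ℂ :=
  ((ContinuousLinearMap.mul ℝ ℂ).flip.comp
    ((Complex.conjCLE : ℂ ≃L[ℝ] ℂ) : ℂ →L[ℝ] ℂ)).flip

lemma mulConj_apply (z w : ℂ) : mulConj z w = z * (starRingEnd ℂ) w := by
  simp [mulConj, mul_comm]

lemma integrable_schwartz_mul_conj {d : ℕ} (f g : SchwartzMap (Euc d) ℂ) :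
    Integrable (fun x => f x * (starRingEnd ℂ) (g x)) := by
  have := (SchwartzMap.bilinLeftCLM mulConj g.hasTemperateGrowth f).integrable (μ := volume)
  simpa [mulConj_apply] using this

lemma integral_schwartzPd_mul_conj {d : ℕ} (f g : SchwartzMap (Euc d) ℂ) (j : Fin d) :
    ∫ x, f x * (starRingEnd ℂ) (schwartzPd j g x) =
      -∫ x, schwartzPd j f x * (starRingEnd ℂ) (g x) := by
  have := SchwartzMap.integral_bilinear_lineDerivOp_right_eq_neg_left (μ := volume) f g mulConj
    (EuclideanSpace.single j (1 : ℝ))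
  simpa only [mulConj_apply] using! this

lemma CinftyBdd.hasTemperateGrowth {d : ℕ} {f : Euc d → ℂ} (hf : CinftyBdd f) :
    f.HasTemperateGrowth := by
  refine ⟨hf.1, fun n => ?_⟩
  obtain ⟨C, hC⟩ := hf.2 n
  exact ⟨0, C, fun x => by simpa using hC x⟩

lemma eLpNorm_two_sq {d : ℕ} (u : SchwartzMap (Euc d) ℂ) :
    eLpNorm (⇑u) 2 volume ^ 2 = ENNReal.ofReal (∫ x, ‖u x‖ ^ 2) := by
  have hn : 0 ≤ ∫ x, ‖u x‖ ^ 2 := integral_nonneg fun x => by positivity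
  rw [(u.memLp 2 volume).eLpNorm_eq_integral_rpow_norm two_ne_zero ENNReal.ofNat_ne_top]
  simp only [ENNReal.toReal_ofNat, Real.rpow_two]
  rw [← ENNReal.ofReal_pow (by positivity), ← Real.rpow_natCast, ← Real.rpow_mul hn]
  norm_num

lemma integral_mul_conj_self {d : ℕ} (u : SchwartzMap (Euc d) ℂ) :
    ∫ x, u x * (starRingEnd ℂ) (u x) = ((∫ x, ‖u x‖ ^ 2 : ℝ) : ℂ) := by
  rw [← integral_complex_ofReal]
  congr 1 with x
  rw [Complex.mul_conj, Complex.normSq_eq_norm_sq]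

/-- The Laplacian as a map of the Schwartz space. -/
def schwartzLap {d : ℕ} (u : SchwartzMap (Euc d) ℂ) : SchwartzMap (Euc d) ℂ :=
  ∑ j, schwartzPd j (schwartzPd j u)

lemma coe_schwartzLap {d : ℕ} (u : SchwartzMap (Euc d) ℂ) : ⇑(schwartzLap u) = lap ⇑u := by
  ext x
  simp [schwartzLap, lap, coe_schwartzPd]

lemma integral_norm_sq_schwartzPd_schwartzPd {d : ℕ} (u : SchwartzMap (Euc d) ℂ)
    (j k : Fin d) :
    ((∫ x, ‖schwartzPd j (schwartzPd k u) x‖ ^ 2 : ℝ) : ℂ) =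
      ∫ x, schwartzPd k (schwartzPd k u) x *
        (starRingEnd ℂ) (schwartzPd j (schwartzPd j u) x) := by
  rw [← integral_mul_conj_self]
  conv_lhs => enter [2, x, 2]; rw [schwartzPd_comm]
  rw [integral_schwartzPd_mul_conj _ _ k, schwartzPd_comm k j,
    ← integral_schwartzPd_mul_conj _ (schwartzPd j u) j]

lemma sum_integral_norm_sq_schwartzPd_schwartzPd {d : ℕ} (u : SchwartzMap (Euc d) ℂ) :
    ∑ j, ∑ k, ∫ x, ‖schwartzPd j (schwartzPd k u) x‖ ^ 2 = ∫ x, ‖schwartzLap u x‖ ^ 2 := by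
  apply Complex.ofReal_injective
  rw [← integral_mul_conj_self]
  simp only [Complex.ofReal_sum, integral_norm_sq_schwartzPd_schwartzPd]
  have h : ∀ x, schwartzLap u x * (starRingEnd ℂ) (schwartzLap u x) =
      ∑ j, ∑ k, schwartzPd k (schwartzPd k u) x *
        (starRingEnd ℂ) (schwartzPd j (schwartzPd j u) x) := by
    intro x
    simp only [schwartzLap, _root_.sum_apply, map_sum]
    rw [Finset.sum_mul_sum, Finset.sum_comm]
  simp only [h]
  rw [integral_finsetSum _ fun j _ => integrable_finsetSum _ fun k _ =>
    integrable_schwartz_mul_conj _ _]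
  exact Finset.sum_congr rfl fun j _ =>
    (integral_finsetSum _ fun k _ => integrable_schwartz_mul_conj _ _).symm

lemma eLpNorm_schwartzPd_schwartzPd_le {d : ℕ} (u : SchwartzMap (Euc d) ℂ) (j k : Fin d) :
    eLpNorm (⇑(schwartzPd j (schwartzPd k u))) 2 volume ≤
      eLpNorm (⇑(schwartzLap u)) 2 volume := by
  rw [← ENNReal.pow_le_pow_left_iff two_ne_zero, eLpNorm_two_sq, eLpNorm_two_sq,
    ← sum_integral_norm_sq_schwartzPd_schwartzPd]
  have h0 : ∀ a b : Fin d, 0 ≤ ∫ x, ‖schwartzPd a (schwartzPd b u) x‖ ^ 2 :=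
    fun a b => integral_nonneg fun x => by positivity
  apply ENNReal.ofReal_le_ofReal
  exact (Finset.single_le_sum (f := fun k => ∫ x, ‖schwartzPd j (schwartzPd k u) x‖ ^ 2)
    (fun b _ => h0 j b) (mem_univ k)).trans
    (Finset.single_le_sum (f := fun j => ∑ k, ∫ x, ‖schwartzPd j (schwartzPd k u) x‖ ^ 2)
      (fun a _ => Finset.sum_nonneg fun b _ => h0 a b) (mem_univ j))

/-- The Gagliardo–Nirenberg–Sobolev inequality for Schwartz functions. -/
lemma SchwartzMap.eLpNorm_le_eLpNorm_fderiv {E F : Type*} [NormedAddCommGroup E]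
    [InnerProductSpace ℝ E] [FiniteDimensional ℝ E] [MeasurableSpace E] [BorelSpace E]
    [NormedAddCommGroup F] [NormedSpace ℝ F] [FiniteDimensional ℝ F]
    (u : SchwartzMap E F) {p p' : NNReal} (hp : 1 ≤ p) (hn : 0 < Module.finrank ℝ E)
    (hp' : (p' : ℝ)⁻¹ = (p : ℝ)⁻¹ - (Module.finrank ℝ E : ℝ)⁻¹) :
    eLpNorm (⇑u) p' volume ≤
      SNormLESNormFDerivOfEqConst F (volume : Measure E) p * eLpNorm (fderiv ℝ ⇑u) p volume := by
  let φ : ContDiffBump (0 : E) := ⟨1, 2, one_pos, one_lt_two⟩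
  let r : ℕ → ℝ := fun n => ((n : ℝ) + 1)⁻¹
  have hr0 : ∀ n, 0 < r n := fun n => by positivity
  have hr : Filter.Tendsto r Filter.atTop (nhds 0) := by
    simpa [r] using tendsto_one_div_add_atTop_nhds_zero_nat (𝕜 := ℝ)
  let χ : ℕ → E → ℝ := fun n x => φ (r n • x)
  have hφd : ContDiff ℝ 1 φ := φ.contDiff
  obtain ⟨M, hM⟩ : ∃ M, ∀ x, ‖fderiv ℝ φ x‖ ≤ M :=
    (hφd.continuous_fderiv one_ne_zero).bounded_above_of_compact_support
      (φ.hasCompactSupport.fderiv ℝ)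
  have hM0 : 0 ≤ M := (norm_nonneg _).trans (hM 0)
  have hχ : ∀ n x, HasFDerivAt (χ n) (r n • fderiv ℝ φ (r n • x)) x := by
    intro n x
    have h1 : HasFDerivAt φ (fderiv ℝ φ (r n • x)) (r n • x) :=
      (hφd.differentiable one_ne_zero _).hasFDerivAt
    have h2 : HasFDerivAt (fun y : E => r n • y) (r n • ContinuousLinearMap.id ℝ E) x :=
      (hasFDerivAt_id x).const_smul (r n)
    convert! h1.comp x h2 using 1
    ext y
    simp
  have hχc : ∀ n, ContDiff ℝ 1 (χ n) := fun n => hφd.comp (contDiff_const_smul (r n))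
  have hu1 : ContDiff ℝ 1 ⇑u := u.smooth 1
  let v : ℕ → E → F := fun n x => χ n x • u x
  have hvc : ∀ n, ContDiff ℝ 1 (v n) := fun n => (hχc n).smul hu1
  have hvs : ∀ n, HasCompactSupport (v n) := fun n => by
    have : HasCompactSupport (χ n) :=
      φ.hasCompactSupport.comp_homeomorph (Homeomorph.smulOfNeZero (r n) (hr0 n).ne')
    exact this.smul_right
  have hfd : ∀ n x, ‖fderiv ℝ (v n) x‖ ≤ ‖fderiv ℝ (⇑u) x‖ + (r n * M) * ‖u x‖ := by
    intro n x
    have h := ((hχ n x).smul (u.hasFDerivAt x)).fderiv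
    have h' : fderiv ℝ (v n) x = _ := h
    rw [h']
    refine (norm_add_le _ _).trans (add_le_add ?_ ?_)
    · rw [norm_smul]
      have : ‖χ n x‖ ≤ 1 := by
        rw [Real.norm_of_nonneg φ.nonneg]; exact φ.le_one
      exact mul_le_of_le_one_left (norm_nonneg _) this
    · refine (ContinuousLinearMap.norm_smulRight_apply _ _).le.trans ?_
      rw [norm_smul, Real.norm_of_nonneg (hr0 n).le]
      gcongr
      exact hM _
  set G := eLpNorm (fderiv ℝ ⇑u) p volume
  set U := eLpNorm (⇑u) p volume
  have hU : U ≠ ⊤ := (u.memLp p volume).eLpNorm_ne_top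
  set C : ENNReal := (SNormLESNormFDerivOfEqConst F (volume : Measure E) p : ENNReal)
  have hbd : ∀ n, eLpNorm (v n) p' volume ≤ C * (G + ENNReal.ofReal (r n * M) * U) := by
    intro n
    refine (MeasureTheory.eLpNorm_le_eLpNorm_fderiv_of_eq volume (hvc n) (hvs n) hp hn hp').trans ?_
    gcongr
    have e1 : eLpNorm (fderiv ℝ (v n)) p volume ≤
        eLpNorm ((fun x => ‖fderiv ℝ (⇑u) x‖) + (fun x => (r n * M) * ‖u x‖)) p volume :=
      eLpNorm_mono_real fun x => hfd n x
    refine e1.trans ((eLpNorm_add_le ?_ ?_ (by exact_mod_cast hp)).trans ?_)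
    · exact (hu1.continuous_fderiv one_ne_zero).norm.aestronglyMeasurable
    · exact (continuous_const.mul u.continuous.norm).aestronglyMeasurable
    · rw [eLpNorm_norm]
      gcongr
      have := eLpNorm_const_smul (r n * M) (fun x => ‖u x‖) p (volume : Measure E)
      rw [eLpNorm_norm, Real.enorm_of_nonneg (mul_nonneg (hr0 n).le hM0)] at this
      exact this.le
  have hlim : ∀ x, Filter.Tendsto (fun n => v n x) Filter.atTop (nhds (u x)) := by
    intro x
    have h1 : Filter.Tendsto (fun n => r n • x) Filter.atTop (nhds 0) := by
      simpa using hr.smul_const x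
    have h2 := (hφd.continuous.tendsto 0).comp h1
    have h3 : φ 0 = 1 := φ.one_of_mem_closedBall (by simp [φ])
    rw [h3] at h2
    simpa using h2.smul_const (u x)
  refine (Lp.eLpNorm_lim_le_liminf_eLpNorm (fun n => (hvc n).continuous.aestronglyMeasurable) _
    (Filter.Eventually.of_forall hlim)).trans ?_
  have ht : Filter.Tendsto (fun n => C * (G + ENNReal.ofReal (r n * M) * U)) Filter.atTop
      (nhds (C * G)) := by
    have h1 : Filter.Tendsto (fun n => ENNReal.ofReal (r n * M)) Filter.atTop (nhds 0) := by
      simpa using ENNReal.tendsto_ofReal (hr.mul_const M)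
    have h2 := ENNReal.Tendsto.mul_const h1 (Or.inr hU)
    have h3 := ENNReal.Tendsto.const_mul (a := C) (h2.const_add G) (Or.inr ENNReal.coe_ne_top)
    simpa using h3
  exact (Filter.liminf_le_liminf (Filter.Eventually.of_forall hbd)).trans ht.liminf_eq.le

lemma norm_fderiv_le_sum_norm_pd {d : ℕ} (u : Euc d → ℂ) (x : Euc d) :
    ‖fderiv ℝ u x‖ ≤ ∑ j, ‖pd j u x‖ := by
  refine ContinuousLinearMap.opNorm_le_bound _ (Finset.sum_nonneg fun _ _ => norm_nonneg _)
    fun y => ?_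
  have hy : y = ∑ j, y j • EuclideanSpace.single j (1 : ℝ) := by
    simpa using ((EuclideanSpace.basisFun (Fin d) ℝ).sum_repr y).symm
  calc ‖fderiv ℝ u x y‖ = ‖∑ j, y j • pd j u x‖ := by
        conv_lhs => rw [hy]
        simp [pd, map_sum]
    _ ≤ ∑ j, ‖y j • pd j u x‖ := norm_sum_le _ _
    _ ≤ ∑ j, ‖pd j u x‖ * ‖y‖ := by
        refine Finset.sum_le_sum fun j _ => ?_
        rw [norm_smul, mul_comm]
        gcongr
        exact PiLp.norm_apply_le y j
    _ = (∑ j, ‖pd j u x‖) * ‖y‖ := (Finset.sum_mul _ _ _).symm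

/-- Multiplication by an `L^d` function is bounded from `Ḣ¹` to `L²`, by Hölder and Sobolev. -/
lemma exists_eLpNorm_mul_le (d : ℕ) (hd : 3 ≤ d) :
    ∃ C : NNReal, ∀ (u : SchwartzMap (Euc d) ℂ) (c : Euc d → ℂ) (G : ℝ≥0∞), Continuous c →
      (∀ j, eLpNorm (⇑(schwartzPd j u)) 2 volume ≤ G) →
      eLpNorm (fun x => c x * u x) 2 volume ≤ eLpNorm c d volume * (C * G) := by
  have hd' : (3 : ℝ) ≤ d := by exact_mod_cast hd
  obtain ⟨q, hq⟩ : ∃ q : NNReal, (q : ℝ) = ((2 : ℝ)⁻¹ - (d : ℝ)⁻¹)⁻¹ := by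
    refine ⟨⟨((2 : ℝ)⁻¹ - (d : ℝ)⁻¹)⁻¹, inv_nonneg.2 (sub_nonneg.2 ?_)⟩, rfl⟩
    exact inv_anti₀ two_pos (by linarith)
  have hq' : (q : ℝ)⁻¹ = (2 : ℝ)⁻¹ - (d : ℝ)⁻¹ := by rw [hq, inv_inv]
  have hq0 : q ≠ 0 := by
    rintro rfl
    have : (d : ℝ)⁻¹ < 2⁻¹ := inv_strictAnti₀ two_pos (by linarith)
    simp only [NNReal.coe_zero, inv_zero] at hq'
    linarith
  have hd0 : (d : NNReal) ≠ 0 := by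
    have : d ≠ 0 := by omega
    exact_mod_cast this
  have hH : ENNReal.HolderTriple (d : ℝ≥0∞) (q : ℝ≥0∞) 2 := by
    refine ⟨?_⟩
    have h1 : (d : NNReal)⁻¹ + q⁻¹ = 2⁻¹ := by
      apply NNReal.coe_injective
      push_cast
      rw [hq']
      ring
    have h2 := congrArg (fun z : NNReal => (z : ℝ≥0∞)) h1
    simpa [ENNReal.coe_inv, hd0, hq0] using h2
  refine ⟨SNormLESNormFDerivOfEqConst ℂ (volume : Measure (Euc d)) (2 : NNReal) * d,
    fun u c G hc hG => ?_⟩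
  refine (eLpNorm_smul_le_mul_eLpNorm (p := d) (q := q) (r := 2)
    u.continuous.aestronglyMeasurable hc.aestronglyMeasurable).trans ?_
  gcongr
  refine (u.eLpNorm_le_eLpNorm_fderiv (p := 2) (by norm_num) (by simp; omega)
    (by simpa using hq')).trans ?_
  rw [ENNReal.coe_mul, mul_assoc]
  gcongr
  have e1 : eLpNorm (fderiv ℝ ⇑u) 2 volume ≤
      eLpNorm (∑ j, fun x => ‖pd j ⇑u x‖) 2 volume :=
    eLpNorm_mono_real fun x => by simpa using norm_fderiv_le_sum_norm_pd (⇑u) x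
  refine e1.trans ((eLpNorm_sum_le (fun j _ =>
    (schwartzPd j u).continuous.norm.aestronglyMeasurable) one_le_two).trans ?_)
  refine (Finset.sum_le_card_nsmul _ _ G fun j _ => ?_).trans (by simp)
  rw [eLpNorm_norm]
  exact hG j

lemma enorm_integral_le_eLpNorm_two_mul {α : Type*} [MeasurableSpace α] {μ : Measure α}
    {F f g : α → ℂ} (hf : AEStronglyMeasurable f μ) (hg : AEStronglyMeasurable g μ)
    (h : ∀ x, ‖F x‖ = ‖f x‖ * ‖g x‖) :
    ‖∫ x, F x ∂μ‖ₑ ≤ eLpNorm f 2 μ * eLpNorm g 2 μ := by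
  refine (enorm_integral_le_lintegral_enorm _).trans ?_
  rw [← eLpNorm_one_eq_lintegral_enorm]
  have e : eLpNorm F 1 μ = eLpNorm (fun x => f x * g x) 1 μ :=
    eLpNorm_congr_norm_ae (Filter.Eventually.of_forall fun x => by rw [h, norm_mul])
  rw [e]
  exact eLpNorm_smul_le_mul_eLpNorm (p := 2) (q := 2) (r := 1) (φ := f) hg hf

lemma eLpNorm_top_mul_le {d : ℕ} (g : Euc d → ℂ) (u : SchwartzMap (Euc d) ℂ) :
    eLpNorm (fun x => g x * u x) 2 volume ≤ eLpNorm g ⊤ volume * eLpNorm (⇑u) 2 volume :=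
  eLpNorm_smul_le_eLpNorm_top_mul_eLpNorm 2 u.continuous.aestronglyMeasurable g

lemma integrable_mul_schwartz_mul_conj {d : ℕ} {c : Euc d → ℂ} (hc : c.HasTemperateGrowth)
    (f g : SchwartzMap (Euc d) ℂ) :
    Integrable (fun x => c x * f x * (starRingEnd ℂ) (g x)) := by
  simpa [SchwartzMap.smulLeftCLM_apply_apply hc] using
    integrable_schwartz_mul_conj (SchwartzMap.smulLeftCLM ℂ c f) g

lemma integral_mul_schwartzPd_mul_conj {d : ℕ} {g : Euc d → ℂ}
    (hg : g.HasTemperateGrowth) (w u : SchwartzMap (Euc d) ℂ) (j : Fin d) :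
    ∫ x, g x * schwartzPd j w x * (starRingEnd ℂ) (u x) =
      -(∫ x, g x * w x * (starRingEnd ℂ) (schwartzPd j u x)) -
        ∫ x, pd j g x * w x * (starRingEnd ℂ) (u x) := by
  set v := SchwartzMap.smulLeftCLM ℂ g w with hv
  have hvx : ∀ x, v x = g x * w x := fun x => SchwartzMap.smulLeftCLM_apply_apply hg w x
  have hprod : ∀ x, schwartzPd j v x = pd j g x * w x + g x * schwartzPd j w x := by
    intro x
    have hgx : HasFDerivAt g (fderiv ℝ g x) x :=
      (hg.1.differentiable (by simp) x).hasFDerivAt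
    have h1 := (hgx.mul (w.hasFDerivAt x)).fderiv
    have h2 : ⇑v = g * ⇑w := funext hvx
    rw [coe_schwartzPd, coe_schwartzPd, pd, pd, pd, h2, h1]
    simp
    ring
  have h0 := integral_schwartzPd_mul_conj v u j
  simp only [hvx] at h0
  have h3 : ∀ x, pd j g x * w x * (starRingEnd ℂ) (u x) =
      schwartzPd j v x * (starRingEnd ℂ) (u x) -
        g x * schwartzPd j w x * (starRingEnd ℂ) (u x) := by
    intro x
    rw [hprod]
    ring
  simp only [h3]
  rw [integral_sub (integrable_schwartz_mul_conj _ _) (integrable_mul_schwartz_mul_conj hg _ _), h0]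
  ring

lemma enorm_integral_mul_schwartzPd_mul_conj_le {d : ℕ} {g : Euc d → ℂ}
    (hg : g.HasTemperateGrowth) (w u : SchwartzMap (Euc d) ℂ) (j : Fin d) :
    ‖∫ x, g x * schwartzPd j w x * (starRingEnd ℂ) (u x)‖ₑ ≤
      eLpNorm g ⊤ volume * eLpNorm (⇑w) 2 volume * eLpNorm (⇑(schwartzPd j u)) 2 volume +
      eLpNorm (⇑w) 2 volume * eLpNorm (fun x => pd j g x * u x) 2 volume := by
  have hpd : Continuous (pd j g) :=
    (hg.1.continuous_fderiv (by simp)).clm_apply continuous_const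
  rw [integral_mul_schwartzPd_mul_conj hg]
  refine (enorm_sub_le (E := ℂ)).trans (add_le_add ?_ ?_)
  · rw [enorm_neg]
    refine (enorm_integral_le_eLpNorm_two_mul (f := fun x => g x * w x) (g := schwartzPd j u)
      (hg.1.continuous.mul w.continuous).aestronglyMeasurable
      (schwartzPd j u).continuous.aestronglyMeasurable fun x => by simp).trans ?_
    gcongr
    exact eLpNorm_top_mul_le g w
  · exact enorm_integral_le_eLpNorm_two_mul w.continuous.aestronglyMeasurable
      (hpd.mul u.continuous).aestronglyMeasurable fun x => by simp; ring

/-- The operator `Σ g_{jk} ∂_j ∂_k + i Σ b_k ∂_k` on Schwartz functions; for `g = a - δ` it equals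
`-(P + Δ)`. -/
def perturb {d : ℕ} (g : Fin d → Fin d → Euc d → ℂ) (b : Fin d → Euc d → ℂ)
    (u : SchwartzMap (Euc d) ℂ) (x : Euc d) : ℂ :=
  (∑ j, ∑ k, g j k x * schwartzPd j (schwartzPd k u) x) +
    Complex.I * ∑ k, b k x * schwartzPd k u x

lemma Pop_eq {d : ℕ} (a : Fin d → Fin d → Euc d → ℂ) (b : Fin d → Euc d → ℂ)
    (u : SchwartzMap (Euc d) ℂ) (x : Euc d) :
    Pop a b ⇑u x = -schwartzLap u x -
      perturb (fun j k x => a j k x - if j = k then 1 else 0) b u x := by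
  have h1 : ∀ j k, Dop j (Dop k ⇑u) x = -schwartzPd j (schwartzPd k u) x := by
    intro j k
    have : Dop k ⇑u = fun y => -Complex.I * schwartzPd k u y := rfl
    rw [this, Dop, pd, fderiv_const_mul (schwartzPd k u).differentiableAt]
    simp only [FunLike.coe_smul, Pi.smul_apply, smul_eq_mul, coe_schwartzPd j, pd]
    linear_combination (fderiv ℝ ⇑(schwartzPd k u) x (EuclideanSpace.single j 1)) * Complex.I_mul_I
  have h2 : ∀ k, Dop k ⇑u x = -Complex.I * schwartzPd k u x := fun k => rfl
  simp only [Pop, perturb, h1, h2, schwartzLap, _root_.sum_apply, sub_mul, ite_mul, one_mul,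
    zero_mul, Finset.sum_sub_distrib, Finset.sum_ite_eq, Finset.mem_univ, if_true, mul_neg,
    neg_mul, Finset.sum_neg_distrib, Finset.mul_sum]
  simp only [mul_left_comm]
  ring

lemma eLpNorm_perturb_le {d : ℕ} {g : Fin d → Fin d → Euc d → ℂ} {b : Fin d → Euc d → ℂ}
    (hg : ∀ j k, (g j k).HasTemperateGrowth) (hb : ∀ k, (b k).HasTemperateGrowth)
    (C : NNReal)
    (hC : ∀ (u : SchwartzMap (Euc d) ℂ) (c : Euc d → ℂ) (G : ℝ≥0∞), Continuous c →
      (∀ j, eLpNorm (⇑(schwartzPd j u)) 2 volume ≤ G) →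
      eLpNorm (fun x => c x * u x) 2 volume ≤ eLpNorm c d volume * (C * G))
    {S : ℝ≥0∞} (hgS : ∀ j k, eLpNorm (g j k) ⊤ volume ≤ S)
    (hbS : ∀ k, eLpNorm (b k) d volume ≤ S) (u : SchwartzMap (Euc d) ℂ) :
    eLpNorm (perturb g b u) 2 volume ≤
      (d * (d * (1 + C) + C)) * S * eLpNorm (⇑(schwartzLap u)) 2 volume := by
  set L := eLpNorm (⇑(schwartzLap u)) 2 volume
  have m1 : ∀ j k, AEStronglyMeasurable (fun x => g j k x * schwartzPd j (schwartzPd k u) x)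
      volume := fun j k =>
    ((hg j k).1.continuous.mul (schwartzPd j (schwartzPd k u)).continuous).aestronglyMeasurable
  have m2 : ∀ k, AEStronglyMeasurable (fun x => b k x * schwartzPd k u x) volume := fun k =>
    ((hb k).1.continuous.mul (schwartzPd k u).continuous).aestronglyMeasurable
  have e : perturb g b u = (∑ j, ∑ k, fun x => g j k x * schwartzPd j (schwartzPd k u) x) +
      Complex.I • ∑ k, fun x => b k x * schwartzPd k u x := by
    ext x
    simp [perturb]
  have b1 : ∀ j k, eLpNorm (fun x => g j k x * schwartzPd j (schwartzPd k u) x) 2 volume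
      ≤ S * L := fun j k =>
    (eLpNorm_top_mul_le _ _).trans
      (mul_le_mul' (hgS j k) (eLpNorm_schwartzPd_schwartzPd_le u j k))
  have b2 : ∀ k, eLpNorm (fun x => b k x * schwartzPd k u x) 2 volume ≤ S * (C * L) := fun k =>
    (hC (schwartzPd k u) (b k) L (hb k).1.continuous
      fun j => eLpNorm_schwartzPd_schwartzPd_le u j k).trans (mul_le_mul_left (hbS k) _)
  have s1 : eLpNorm (∑ j, ∑ k, fun x => g j k x * schwartzPd j (schwartzPd k u) x) 2 volume
      ≤ d * (d * (S * L)) := by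
    refine (eLpNorm_sum_le (fun j _ => Finset.aestronglyMeasurable_sum _ fun k _ => m1 j k)
      one_le_two).trans ((Finset.sum_le_card_nsmul _ _ (d * (S * L)) fun j _ => ?_).trans (by simp))
    exact (eLpNorm_sum_le (fun k _ => m1 j k) one_le_two).trans
      ((Finset.sum_le_card_nsmul _ _ (S * L) fun k _ => b1 j k).trans (by simp))
  have s2 : eLpNorm (∑ k, fun x => b k x * schwartzPd k u x) 2 volume ≤ d * (S * (C * L)) :=
    (eLpNorm_sum_le (fun k _ => m2 k) one_le_two).trans
      ((Finset.sum_le_card_nsmul _ _ (S * (C * L)) fun k _ => b2 k).trans (by simp))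
  rw [e]
  refine (eLpNorm_add_le (Finset.aestronglyMeasurable_sum _ fun j _ =>
    Finset.aestronglyMeasurable_sum _ fun k _ => m1 j k)
    ((Finset.aestronglyMeasurable_sum _ fun k _ => m2 k).const_smul _) one_le_two).trans ?_
  rw [eLpNorm_const_smul]
  have hI : ‖Complex.I‖ₑ = 1 := by simp [← ofReal_norm]
  rw [hI, one_mul]
  refine (add_le_add s1 s2).trans ?_
  calc (d : ℝ≥0∞) * (d * (S * L)) + d * (S * (C * L)) = (d * (d * 1 + C)) * S * L := by ring
    _ ≤ (d * (d * (1 + C) + C)) * S * L := by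
      gcongr
      exact le_self_add

lemma integrable_perturb_mul_conj {d : ℕ} {g : Fin d → Fin d → Euc d → ℂ}
    {b : Fin d → Euc d → ℂ} (hg : ∀ j k, (g j k).HasTemperateGrowth)
    (hb : ∀ k, (b k).HasTemperateGrowth) (u : SchwartzMap (Euc d) ℂ) :
    Integrable (fun x => perturb g b u x * (starRingEnd ℂ) (u x)) ∧
    ∫ x, perturb g b u x * (starRingEnd ℂ) (u x) =
      (∑ j, ∑ k, ∫ x, g j k x * schwartzPd j (schwartzPd k u) x * (starRingEnd ℂ) (u x)) +
        Complex.I * ∑ k, ∫ x, b k x * schwartzPd k u x * (starRingEnd ℂ) (u x) := by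
  have e : ∀ x, perturb g b u x * (starRingEnd ℂ) (u x) =
      (∑ j, ∑ k, g j k x * schwartzPd j (schwartzPd k u) x * (starRingEnd ℂ) (u x)) +
        Complex.I * ∑ k, b k x * schwartzPd k u x * (starRingEnd ℂ) (u x) := by
    intro x
    simp only [perturb, add_mul, Finset.sum_mul, mul_assoc]
  have i1 : ∀ j k, Integrable (fun x => g j k x * schwartzPd j (schwartzPd k u) x *
      (starRingEnd ℂ) (u x)) := fun j k => integrable_mul_schwartz_mul_conj (hg j k) _ _
  have i2 : ∀ k, Integrable (fun x => b k x * schwartzPd k u x * (starRingEnd ℂ) (u x)) :=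
    fun k => integrable_mul_schwartz_mul_conj (hb k) _ _
  have j1 := integrable_finsetSum univ fun j _ => integrable_finsetSum univ fun k _ => i1 j k
  have j2 := (integrable_finsetSum univ fun k _ => i2 k).const_mul Complex.I
  simp only [e]
  refine ⟨j1.add j2, ?_⟩
  rw [integral_add j1 j2, integral_const_mul, integral_finsetSum _ fun k _ => i2 k,
    integral_finsetSum _ fun j _ => integrable_finsetSum univ fun k _ => i1 j k]
  congr 1
  exact Finset.sum_congr rfl fun j _ => integral_finsetSum _ fun k _ => i1 j k

lemma enorm_integral_perturb_le {d : ℕ} {g : Fin d → Fin d → Euc d → ℂ} {b : Fin d → Euc d → ℂ}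
    (hg : ∀ j k, (g j k).HasTemperateGrowth) (hb : ∀ k, (b k).HasTemperateGrowth)
    (C : NNReal)
    (hC : ∀ (u : SchwartzMap (Euc d) ℂ) (c : Euc d → ℂ) (G : ℝ≥0∞), Continuous c →
      (∀ j, eLpNorm (⇑(schwartzPd j u)) 2 volume ≤ G) →
      eLpNorm (fun x => c x * u x) 2 volume ≤ eLpNorm c d volume * (C * G))
    {S : ℝ≥0∞} (hgS : ∀ j k, eLpNorm (g j k) ⊤ volume ≤ S)
    (hdgS : ∀ j k l, eLpNorm (pd l (g j k)) d volume ≤ S)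
    (hbS : ∀ k, eLpNorm (b k) d volume ≤ S) (u : SchwartzMap (Euc d) ℂ) {G : ℝ≥0∞}
    (hG : ∀ j, eLpNorm (⇑(schwartzPd j u)) 2 volume ≤ G) :
    ‖∫ x, perturb g b u x * (starRingEnd ℂ) (u x)‖ₑ ≤
      (d * (d * (1 + C) + C)) * S * G ^ 2 := by
  rw [(integrable_perturb_mul_conj hg hb u).2]
  have hpd : ∀ j k l, Continuous (pd l (g j k)) := fun j k l =>
    ((hg j k).1.continuous_fderiv (by simp)).clm_apply continuous_const
  have b1 : ∀ j k, ‖∫ x, g j k x * schwartzPd j (schwartzPd k u) x * (starRingEnd ℂ) (u x)‖ₑ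
      ≤ S * G * G + G * (S * (C * G)) := fun j k => by
    refine (enorm_integral_mul_schwartzPd_mul_conj_le (hg j k) _ u j).trans ?_
    gcongr
    · exact hgS j k
    · exact hG k
    · exact hG j
    · exact hG k
    · exact (hC u _ G (hpd j k j) hG).trans (mul_le_mul_left (hdgS j k j) _)
  have b2 : ∀ k, ‖∫ x, b k x * schwartzPd k u x * (starRingEnd ℂ) (u x)‖ₑ ≤
      G * (S * (C * G)) := fun k => by
    refine (enorm_integral_le_eLpNorm_two_mul (f := schwartzPd k u) (g := fun x => b k x * u x)
      (schwartzPd k u).continuous.aestronglyMeasurable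
      ((hb k).1.continuous.mul u.continuous).aestronglyMeasurable
      fun x => by simp; ring).trans ?_
    gcongr
    · exact hG k
    · exact (hC u _ G (hb k).1.continuous hG).trans (mul_le_mul_left (hbS k) _)
  refine (enorm_add_le _ _).trans ?_
  have hI : ‖Complex.I‖ₑ = 1 := by simp [← ofReal_norm]
  rw [enorm_mul, hI, one_mul]
  have s2 : ‖∑ k, ∫ x, b k x * schwartzPd k u x * (starRingEnd ℂ) (u x)‖ₑ ≤
      d * (G * (S * (C * G))) :=
    (enorm_sum_le _ _).trans ((Finset.sum_le_card_nsmul _ _ _ fun k _ => b2 k).trans (by simp))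
  have s1 : ‖∑ j, ∑ k, ∫ x, g j k x * schwartzPd j (schwartzPd k u) x *
      (starRingEnd ℂ) (u x)‖ₑ ≤ d * (d * (S * G * G + G * (S * (C * G)))) := by
    refine (enorm_sum_le _ _).trans ((Finset.sum_le_card_nsmul _ _
      (d * (S * G * G + G * (S * (C * G)))) fun j _ => ?_).trans (by simp))
    exact (enorm_sum_le _ _).trans
      ((Finset.sum_le_card_nsmul _ _ _ fun k _ => b1 j k).trans (by
        simp only [card_univ, Fintype.card_fin, nsmul_eq_mul, le_refl]))
  refine (add_le_add s1 s2).trans_eq ?_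
  ring

lemma integral_neg_schwartzLap_mul_conj {d : ℕ} (u : SchwartzMap (Euc d) ℂ) :
    Integrable (fun x => -schwartzLap u x * (starRingEnd ℂ) (u x)) ∧
      ∫ x, -schwartzLap u x * (starRingEnd ℂ) (u x) = (gradSq ⇑u : ℂ) := by
  have h : ∀ x, -schwartzLap u x * (starRingEnd ℂ) (u x) =
      ∑ j, -(schwartzPd j (schwartzPd j u) x * (starRingEnd ℂ) (u x)) := by
    intro x
    simp only [schwartzLap, _root_.sum_apply, ← Finset.sum_neg_distrib, Finset.sum_mul, neg_mul]
  have hi : ∀ j, Integrable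
      (fun x => -(schwartzPd j (schwartzPd j u) x * (starRingEnd ℂ) (u x))) :=
    fun j => (integrable_schwartz_mul_conj _ _).neg
  simp only [h]
  refine ⟨integrable_finsetSum _ fun j _ => hi j, ?_⟩
  rw [integral_finsetSum _ fun j _ => hi j, gradSq, Complex.ofReal_sum]
  refine Finset.sum_congr rfl fun j _ => ?_
  rw [integral_neg, ← integral_schwartzPd_mul_conj, integral_mul_conj_self, coe_schwartzPd]

lemma gradSq_nonneg {d : ℕ} (u : Euc d → ℂ) : 0 ≤ gradSq u :=
  Finset.sum_nonneg fun _ _ => integral_nonneg fun _ => by positivity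

lemma eLpNorm_schwartzPd_le_gradSq {d : ℕ} (u : SchwartzMap (Euc d) ℂ) (j : Fin d) :
    eLpNorm (⇑(schwartzPd j u)) 2 volume ≤ ENNReal.ofReal (Real.sqrt (gradSq ⇑u)) := by
  rw [← ENNReal.pow_le_pow_left_iff two_ne_zero, eLpNorm_two_sq,
    ← ENNReal.ofReal_pow (Real.sqrt_nonneg _), Real.sq_sqrt (gradSq_nonneg _)]
  exact ENNReal.ofReal_le_ofReal (Finset.single_le_sum (f := fun j => ∫ x, ‖pd j ⇑u x‖ ^ 2)
    (fun a _ => integral_nonneg fun x => by positivity) (mem_univ j))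

lemma CinftyBdd.hasTemperateGrowth_sub_const {d : ℕ} {f : Euc d → ℂ} (hf : CinftyBdd f) (c : ℂ) :
    (fun x => f x - c).HasTemperateGrowth :=
  hf.hasTemperateGrowth.sub (Function.HasTemperateGrowth.const c)

/-- There is `ε > 0` (depending only on `d`) such that for every symmetric
`P = Σ a_{jk} D_j D_k + Σ b_k D_k` with `C^∞_b` coefficients satisfying
`Σ_{j,k}(‖a_{jk} - δ_{jk}‖_{L^∞} + Σ_l ‖∂_l a_{jk}‖_{L^d}) + Σ_k ‖b_k‖_{L^d} < ε`,
one has for all Schwartz `u`: `⟨Pu,u⟩` is real,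
`(1/2)‖∇u‖² ≤ ⟨Pu,u⟩ ≤ 2‖∇u‖²`, `(1/2)‖Δu‖ ≤ ‖Pu‖ ≤ 2‖Δu‖`, and `⟨Pu,u⟩ ≥ 0`. -/
theorem statement3 (d : ℕ) (hd : 3 ≤ d) :
    ∃ ε : ℝ, 0 < ε ∧
      ∀ (a : Fin d → Fin d → Euc d → ℂ) (b : Fin d → Euc d → ℂ),
        (∀ j k, CinftyBdd (a j k)) → (∀ k, CinftyBdd (b k)) →
        IsSymmP a b →
        (∑ j : Fin d, ∑ k : Fin d,
            (eLpNorm (fun x => a j k x - if j = k then 1 else 0) ⊤ volume +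
              ∑ l : Fin d, eLpNorm (pd l (a j k)) (d : ℝ≥0∞) volume)) +
          ∑ k : Fin d, eLpNorm (b k) (d : ℝ≥0∞) volume < ENNReal.ofReal ε →
        ∀ u : SchwartzMap (Euc d) ℂ,
          ((∫ x, Pop a b ⇑u x * (starRingEnd ℂ) (u x)).im = 0 ∧
            (1 / 2 : ℝ) * gradSq ⇑u ≤ (∫ x, Pop a b ⇑u x * (starRingEnd ℂ) (u x)).re ∧
            (∫ x, Pop a b ⇑u x * (starRingEnd ℂ) (u x)).re ≤ 2 * gradSq ⇑u) ∧
          (eLpNorm (lap ⇑u) 2 volume / 2 ≤ eLpNorm (Pop a b ⇑u) 2 volume ∧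
            eLpNorm (Pop a b ⇑u) 2 volume ≤ 2 * eLpNorm (lap ⇑u) 2 volume) ∧
          0 ≤ (∫ x, Pop a b ⇑u x * (starRingEnd ℂ) (u x)).re := by
  obtain ⟨C, hC⟩ := exists_eLpNorm_mul_le d hd
  set K : NNReal := d * (d * (1 + C) + C) with hK
  refine ⟨1 / (2 * (K + 1)), by positivity, fun a b ha hb hsymm hsmall u => ?_⟩
  set S : ℝ≥0∞ := _ with hS
  change S < _ at hsmall
  have hjk : ∀ j k, eLpNorm (fun x => a j k x - if j = k then 1 else 0) ⊤ volume +
      ∑ l : Fin d, eLpNorm (pd l (a j k)) (d : ℝ≥0∞) volume ≤ S := by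
    intro j k
    refine le_trans ?_ le_self_add
    exact (Finset.single_le_sum (f := fun k =>
        eLpNorm (fun x => a j k x - if j = k then 1 else 0) ⊤ volume +
          ∑ l : Fin d, eLpNorm (pd l (a j k)) (d : ℝ≥0∞) volume)
        (fun _ _ => zero_le) (mem_univ k)).trans
      (Finset.single_le_sum (f := fun j => ∑ k,
        (eLpNorm (fun x => a j k x - if j = k then 1 else 0) ⊤ volume +
          ∑ l : Fin d, eLpNorm (pd l (a j k)) (d : ℝ≥0∞) volume))
        (fun _ _ => zero_le) (mem_univ j))
  have hbS : ∀ k, eLpNorm (b k) d volume ≤ S := fun k =>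
    (Finset.single_le_sum (f := fun k => eLpNorm (b k) (d : ℝ≥0∞) volume)
      (fun _ _ => zero_le) (mem_univ k)).trans le_add_self
  set g : Fin d → Fin d → Euc d → ℂ := fun j k x => a j k x - if j = k then 1 else 0 with hg
  have hgS : ∀ j k, eLpNorm (g j k) ⊤ volume ≤ S := fun j k => le_self_add.trans (hjk j k)
  have hdgS : ∀ j k l, eLpNorm (pd l (g j k)) d volume ≤ S := by
    intro j k l
    have e : pd l (g j k) = pd l (a j k) := by
      ext x
      simp only [pd, hg, fderiv_sub_const]
    rw [e]
    exact (Finset.single_le_sum (f := fun l => eLpNorm (pd l (a j k)) (d : ℝ≥0∞) volume)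
      (fun _ _ => zero_le) (mem_univ l)).trans (le_add_self.trans (hjk j k))
  have hgT : ∀ j k, (g j k).HasTemperateGrowth :=
    fun j k => (ha j k).hasTemperateGrowth_sub_const _
  have hbT : ∀ k, (b k).HasTemperateGrowth := fun k => (hb k).hasTemperateGrowth
  have hKS : (d * (d * (1 + C) + C)) * S ≤ 2⁻¹ := by
    have e : ((d : ℝ≥0∞) * (d * (1 + C) + C)) = ENNReal.ofReal K := by
      rw [ENNReal.ofReal_coe_nnreal, hK]
      push_cast
      rfl
    have e2 : (2⁻¹ : ℝ≥0∞) = ENNReal.ofReal 2⁻¹ := by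
      rw [ENNReal.ofReal_inv_of_pos two_pos]
      simp
    rw [e, e2]
    refine (mul_le_mul_right hsmall.le _).trans ?_
    rw [← ENNReal.ofReal_mul (by positivity)]
    apply ENNReal.ofReal_le_ofReal
    rw [mul_one_div, div_le_iff₀ (by positivity)]
    linarith
  have hN : eLpNorm (perturb g b u) 2 volume ≤ 2⁻¹ * eLpNorm (lap ⇑u) 2 volume := by
    rw [← coe_schwartzLap]
    exact (eLpNorm_perturb_le hgT hbT C hC hgS hbS u).trans (mul_le_mul_left hKS _)
  have hR : ‖∫ x, perturb g b u x * (starRingEnd ℂ) (u x)‖ ≤ 2⁻¹ * gradSq ⇑u := by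
    have h1 := (enorm_integral_perturb_le hgT hbT C hC hgS hdgS hbS u
      (eLpNorm_schwartzPd_le_gradSq u)).trans (mul_le_mul_left hKS _)
    have e2 : (2⁻¹ : ℝ≥0∞) = ENNReal.ofReal 2⁻¹ := by
      rw [ENNReal.ofReal_inv_of_pos two_pos]
      simp
    rw [← ENNReal.ofReal_pow (Real.sqrt_nonneg _), Real.sq_sqrt (gradSq_nonneg _), e2,
      ← ENNReal.ofReal_mul (by norm_num), ← ofReal_norm] at h1
    exact (ENNReal.ofReal_le_ofReal_iff
      (mul_nonneg (by norm_num) (gradSq_nonneg _))).1 h1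
  have hP : ∀ x, Pop a b ⇑u x = -schwartzLap u x - perturb g b u x := Pop_eq a b u
  have hmain : ∫ x, Pop a b ⇑u x * (starRingEnd ℂ) (u x) =
      (gradSq ⇑u : ℂ) - ∫ x, perturb g b u x * (starRingEnd ℂ) (u x) := by
    simp only [hP, sub_mul]
    rw [integral_sub (integral_neg_schwartzLap_mul_conj u).1
      (integrable_perturb_mul_conj hgT hbT u).1, (integral_neg_schwartzLap_mul_conj u).2]
  have him : (∫ x, Pop a b ⇑u x * (starRingEnd ℂ) (u x)).im = 0 := by
    rw [← Complex.conj_eq_iff_im, ← integral_conj]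
    refine Eq.trans ?_ (hsymm u u).symm
    congr 1 with x
    simp [mul_comm]
  have hre : |(∫ x, Pop a b ⇑u x * (starRingEnd ℂ) (u x)).re - gradSq ⇑u| ≤
      2⁻¹ * gradSq ⇑u := by
    rw [hmain, Complex.sub_re, Complex.ofReal_re, sub_sub_cancel_left, abs_neg]
    exact (Complex.abs_re_le_norm _).trans hR
  obtain ⟨hre1, hre2⟩ := abs_le.1 hre
  have hG := gradSq_nonneg ⇑u
  have hpc : Continuous (perturb g b u) := by
    have h1 : ∀ j k, Continuous (g j k) := fun j k => (hgT j k).1.continuous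
    have h2 : ∀ k, Continuous (b k) := fun k => (hbT k).1.continuous
    have h3 : ∀ v : SchwartzMap (Euc d) ℂ, Continuous ⇑v := fun v => v.continuous
    unfold perturb
    fun_prop
  have hL : eLpNorm (lap ⇑u) 2 volume ≠ ⊤ := by
    rw [← coe_schwartzLap]
    exact ((schwartzLap u).memLp 2 volume).eLpNorm_ne_top
  have hLm : AEStronglyMeasurable (lap ⇑u) (volume : Measure (Euc d)) := by
    rw [← coe_schwartzLap]
    exact (schwartzLap u).continuous.aestronglyMeasurable
  have hPe : Pop a b ⇑u = -lap ⇑u - perturb g b u := by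
    ext x
    rw [hP, coe_schwartzLap]
    rfl
  have hPm : AEStronglyMeasurable (Pop a b ⇑u) (volume : Measure (Euc d)) := by
    rw [hPe]
    exact hLm.neg.sub hpc.aestronglyMeasurable
  refine ⟨⟨him, by linarith, by linarith⟩, ⟨?_, ?_⟩, by linarith⟩
  · have h1 : eLpNorm (lap ⇑u) 2 volume ≤
        eLpNorm (Pop a b ⇑u) 2 volume + 2⁻¹ * eLpNorm (lap ⇑u) 2 volume := by
      calc eLpNorm (lap ⇑u) 2 volume = eLpNorm (Pop a b ⇑u + perturb g b u) 2 volume := by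
            rw [hPe, sub_add_cancel, eLpNorm_neg]
        _ ≤ _ := eLpNorm_add_le hPm hpc.aestronglyMeasurable one_le_two
        _ ≤ _ := by gcongr
    rw [div_eq_mul_inv, mul_comm]
    have h2 : (2⁻¹ : ℝ≥0∞) * eLpNorm (lap ⇑u) 2 volume ≠ ⊤ := ENNReal.mul_ne_top (by simp) hL
    refine (ENNReal.add_le_add_iff_right h2).1 (le_trans ?_ h1)
    rw [← add_mul, ENNReal.inv_two_add_inv_two, one_mul]
  · calc eLpNorm (Pop a b ⇑u) 2 volume ≤
          eLpNorm (lap ⇑u) 2 volume + eLpNorm (perturb g b u) 2 volume := by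
          rw [hPe, ← eLpNorm_neg (lap ⇑u)]
          exact eLpNorm_sub_le hLm.neg hpc.aestronglyMeasurable one_le_two
      _ ≤ eLpNorm (lap ⇑u) 2 volume + 1 * eLpNorm (lap ⇑u) 2 volume := by
          gcongr
          exact hN.trans (mul_le_mul_left (by simp) _)
      _ = 2 * eLpNorm (lap ⇑u) 2 volume := by rw [one_mul, two_mul]
end
end

section
/- Let d ≥ 3 and n ≥ 1. For Schwartz functions u on ℝ^d and P u = Σ_{j,k} a_{jk}(x) D_j D_k u + Σ_k b_k(x) D_k u with smooth coefficients, define the iterated commutators ad_A⁰ P = P, ad_A P = PA − AP, ad_A^n P = (ad_A^{n−1} P) A − A (ad_A^{n−1} P), where A = (x·∇)/i + d/2 is the generator of dilations, all viewed as differential operators on Schwartz functions. Then for every Schwartz function u: i^n (ad_A^n P) u = Σ_{j,k} ((2 − x·∇)^n a_{jk})(x) D_j D_k u + Σ_k ((1 − x·∇)^n b_k)(x) D_k u, where (2 − x·∇) and (1 − x·∇) act on the coefficient functions and are iterated n times. -/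
open MeasureTheory Complex Finset
open scoped ENNReal

noncomputable section

/-- The operator `c - x·∇` acting on coefficient functions. -/
def coefT {d : ℕ} (c : ℂ) (f : Euc d → ℂ) : Euc d → ℂ :=
  fun x => c * f x - xGrad f x

lemma xGrad_eq_fderiv {d : ℕ} (u : Euc d → ℂ) : xGrad u = fun x => fderiv ℝ u x x := by
  funext x
  have hx : x = ∑ j, x j • (EuclideanSpace.single j (1 : ℝ) : Euc d) := by
    ext i
    simp [Finset.sum_apply, Pi.single_apply]
  have h := congrArg (fderiv ℝ u x) hx
  simp only [map_sum, map_smul] at h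
  rw [h]
  simp [xGrad, pd]

lemma contDiff_pd {d : ℕ} {u : Euc d → ℂ} (hu : ContDiff ℝ (⊤ : ℕ∞) u) (j : Fin d) :
    ContDiff ℝ (⊤ : ℕ∞) (pd j u) :=
  (hu.fderiv_right (m := (⊤ : ℕ∞)) (by simp)).clm_apply contDiff_const

lemma contDiff_xGrad {d : ℕ} {u : Euc d → ℂ} (hu : ContDiff ℝ (⊤ : ℕ∞) u) :
    ContDiff ℝ (⊤ : ℕ∞) (xGrad u) := by
  rw [xGrad_eq_fderiv]
  exact (hu.fderiv_right (m := (⊤ : ℕ∞)) (by simp)).clm_apply contDiff_id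

lemma contDiff_Dop {d : ℕ} {u : Euc d → ℂ} (hu : ContDiff ℝ (⊤ : ℕ∞) u) (j : Fin d) :
    ContDiff ℝ (⊤ : ℕ∞) (Dop j u) :=
  contDiff_const.mul (contDiff_pd hu j)

lemma contDiff_Aop {d : ℕ} {u : Euc d → ℂ} (hu : ContDiff ℝ (⊤ : ℕ∞) u) :
    ContDiff ℝ (⊤ : ℕ∞) (Aop u) :=
  (contDiff_const.mul (contDiff_xGrad hu)).add (contDiff_const.mul hu)

lemma contDiff_coefT {d : ℕ} {f : Euc d → ℂ} (hf : ContDiff ℝ (⊤ : ℕ∞) f) (c : ℂ) :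
    ContDiff ℝ (⊤ : ℕ∞) (coefT c f) :=
  (contDiff_const.mul hf).sub (contDiff_xGrad hf)

lemma contDiff_iterate_coefT {d : ℕ} {f : Euc d → ℂ} (hf : ContDiff ℝ (⊤ : ℕ∞) f) (c : ℂ)
    (n : ℕ) : ContDiff ℝ (⊤ : ℕ∞) ((coefT c)^[n] f) := by
  induction n with
  | zero => exact hf
  | succ n ih =>
    rw [Function.iterate_succ_apply']
    exact contDiff_coefT ih c

lemma contDiff_Pop {d : ℕ} {a : Fin d → Fin d → Euc d → ℂ} {b : Fin d → Euc d → ℂ}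
    {u : Euc d → ℂ} (ha : ∀ j k, ContDiff ℝ (⊤ : ℕ∞) (a j k))
    (hb : ∀ k, ContDiff ℝ (⊤ : ℕ∞) (b k)) (hu : ContDiff ℝ (⊤ : ℕ∞) u) :
    ContDiff ℝ (⊤ : ℕ∞) (Pop a b u) :=
  (ContDiff.sum fun j _ => ContDiff.sum fun k _ =>
    (ha j k).mul (contDiff_Dop (contDiff_Dop hu k) j)).add
    (ContDiff.sum fun k _ => (hb k).mul (contDiff_Dop hu k))

lemma pd_add {d : ℕ} {u v : Euc d → ℂ} (hu : Differentiable ℝ u) (hv : Differentiable ℝ v)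
    (j : Fin d) (x : Euc d) : pd j (fun y => u y + v y) x = pd j u x + pd j v x := by
  simp [pd, fderiv_fun_add (hu x) (hv x)]

lemma pd_const_mul {d : ℕ} {u : Euc d → ℂ} (hu : Differentiable ℝ u) (c : ℂ)
    (j : Fin d) (x : Euc d) : pd j (fun y => c * u y) x = c * pd j u x := by
  simp [pd, fderiv_const_mul (hu x) c]

lemma xGrad_add {d : ℕ} {u v : Euc d → ℂ} (hu : Differentiable ℝ u) (hv : Differentiable ℝ v)
    (x : Euc d) : xGrad (fun y => u y + v y) x = xGrad u x + xGrad v x := by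
  simp [xGrad_eq_fderiv, fderiv_fun_add (hu x) (hv x)]

lemma xGrad_sum {d : ℕ} {ι : Type*} (s : Finset ι) {u : ι → Euc d → ℂ}
    (hu : ∀ i, Differentiable ℝ (u i)) (x : Euc d) :
    xGrad (fun y => ∑ i ∈ s, u i y) x = ∑ i ∈ s, xGrad (u i) x := by
  simp [xGrad_eq_fderiv, fderiv_fun_sum fun i _ => hu i x]

lemma xGrad_mul {d : ℕ} {u v : Euc d → ℂ} (hu : Differentiable ℝ u) (hv : Differentiable ℝ v)
    (x : Euc d) : xGrad (fun y => u y * v y) x = u x * xGrad v x + xGrad u x * v x := by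
  simp [xGrad_eq_fderiv, fderiv_fun_mul (hu x) (hv x), mul_comm]

lemma xGrad_const_mul {d : ℕ} {u : Euc d → ℂ} (hu : Differentiable ℝ u) (c : ℂ)
    (x : Euc d) : xGrad (fun y => c * u y) x = c * xGrad u x := by
  simp [xGrad_eq_fderiv, fderiv_const_mul (hu x) c]

lemma pd_xGrad {d : ℕ} {u : Euc d → ℂ} (hu : ContDiff ℝ (⊤ : ℕ∞) u) (j : Fin d) (x : Euc d) :
    pd j (xGrad u) x = xGrad (pd j u) x + pd j u x := by
  have hf : DifferentiableAt ℝ (fderiv ℝ u) x :=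
    ((hu.fderiv_right (m := (⊤ : ℕ∞)) (by simp)).differentiable (by simp)) x
  have hs : IsSymmSndFDerivAt ℝ u x :=
    hu.contDiffAt.isSymmSndFDerivAt (by
      rw [minSmoothness_of_isRCLikeNormedField]
      exact WithTop.coe_le_coe.2 le_top)
  have h1 : fderiv ℝ (fun y => fderiv ℝ u y y) x =
      (fderiv ℝ u x).comp (fderiv ℝ (fun y => y) x) + (fderiv ℝ (fderiv ℝ u) x).flip x :=
    fderiv_clm_apply hf differentiableAt_fun_id
  have h2 : fderiv ℝ (pd j u) x x =
      fderiv ℝ (fderiv ℝ u) x x (EuclideanSpace.single j 1) := by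
    unfold pd
    rw [fderiv_clm_apply hf (differentiableAt_const _)]
    simp
  rw [xGrad_eq_fderiv, xGrad_eq_fderiv]
  simp only [h2]
  simp only [pd, h1]
  simp [hs.eq x, add_comm]

lemma Dop_Aop {d : ℕ} {u : Euc d → ℂ} (hu : ContDiff ℝ (⊤ : ℕ∞) u) (j : Fin d) :
    Dop j (Aop u) = fun x => Aop (Dop j u) x + -I * Dop j u x := by
  funext x
  have hu' := hu.differentiable (by simp)
  have hx' := (contDiff_xGrad hu).differentiable (by simp)
  have hp' := (contDiff_pd hu j).differentiable (by simp)
  unfold Dop Aop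
  rw [pd_add (hx'.const_mul _) (hu'.const_mul _), pd_const_mul hx', pd_const_mul hu',
    pd_xGrad hu, xGrad_const_mul hp']
  ring

lemma Dop_Dop_Aop {d : ℕ} {u : Euc d → ℂ} (hu : ContDiff ℝ (⊤ : ℕ∞) u) (j k : Fin d)
    (x : Euc d) :
    Dop j (Dop k (Aop u)) x = Aop (Dop j (Dop k u)) x + -I * (2 * Dop j (Dop k u) x) := by
  have hk := contDiff_Dop hu k
  have hk' := hk.differentiable (by simp)
  have hA' := (contDiff_Aop hk).differentiable (by simp)
  have h := congrFun (Dop_Aop hk j) x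
  rw [Dop_Aop hu]
  change -I * pd j (Aop (Dop k u)) x = _ at h
  change -I * pd j (fun y => Aop (Dop k u) y + -I * Dop k u y) x = _
  rw [pd_add hA' (hk'.const_mul _), pd_const_mul hk', mul_add, h]
  simp only [Dop]
  ring

lemma Aop_add {d : ℕ} {u v : Euc d → ℂ} (hu : Differentiable ℝ u) (hv : Differentiable ℝ v)
    (x : Euc d) : Aop (fun y => u y + v y) x = Aop u x + Aop v x := by
  unfold Aop
  rw [xGrad_add hu hv]
  ring

lemma Aop_sum {d : ℕ} {ι : Type*} (s : Finset ι) {u : ι → Euc d → ℂ}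
    (hu : ∀ i, Differentiable ℝ (u i)) (x : Euc d) :
    Aop (fun y => ∑ i ∈ s, u i y) x = ∑ i ∈ s, Aop (u i) x := by
  unfold Aop
  rw [xGrad_sum s hu, Finset.mul_sum, Finset.mul_sum, Finset.sum_add_distrib]

lemma Aop_mul {d : ℕ} {u v : Euc d → ℂ} (hu : Differentiable ℝ u) (hv : Differentiable ℝ v)
    (x : Euc d) : Aop (fun y => u y * v y) x = u x * Aop v x - I * xGrad u x * v x := by
  unfold Aop
  rw [xGrad_mul hu hv]
  ring

lemma Aop_const_mul {d : ℕ} {u : Euc d → ℂ} (hu : Differentiable ℝ u) (c : ℂ)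
    (x : Euc d) : Aop (fun y => c * u y) x = c * Aop u x := by
  unfold Aop
  rw [xGrad_const_mul hu]
  ring

lemma Pop_Aop_sub_Aop_Pop {d : ℕ} {a : Fin d → Fin d → Euc d → ℂ} {b : Fin d → Euc d → ℂ}
    {u : Euc d → ℂ} (ha : ∀ j k, ContDiff ℝ (⊤ : ℕ∞) (a j k))
    (hb : ∀ k, ContDiff ℝ (⊤ : ℕ∞) (b k)) (hu : ContDiff ℝ (⊤ : ℕ∞) u) (x : Euc d) :
    Pop a b (Aop u) x - Aop (Pop a b u) x =
      -I * Pop (fun j k => coefT 2 (a j k)) (fun k => coefT 1 (b k)) u x := by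
  have ha' := fun j k => (ha j k).differentiable (by simp)
  have hb' := fun k => (hb k).differentiable (by simp)
  have hD := fun k => (contDiff_Dop hu k).differentiable (by simp)
  have hDD := fun j k => (contDiff_Dop (contDiff_Dop hu k) j).differentiable (by simp)
  have h2 := fun j k => (ha' j k).fun_mul (hDD j k)
  have h1 := fun k => (hb' k).fun_mul (hD k)
  have hA : Aop (Pop a b u) x =
      (∑ j, ∑ k, (a j k x * Aop (Dop j (Dop k u)) x
        - I * xGrad (a j k) x * Dop j (Dop k u) x)) +
      ∑ k, (b k x * Aop (Dop k u) x - I * xGrad (b k) x * Dop k u x) := by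
    unfold Pop
    rw [Aop_add (Differentiable.fun_sum fun j _ => Differentiable.fun_sum fun k _ => h2 j k)
      (Differentiable.fun_sum fun k _ => h1 k),
      Aop_sum _ (fun j => Differentiable.fun_sum fun k _ => h2 j k), Aop_sum _ h1]
    simp_rw [Aop_mul (hb' _) (hD _)]
    congr 1
    refine Finset.sum_congr rfl fun j _ => ?_
    rw [Aop_sum _ (h2 j)]
    simp_rw [Aop_mul (ha' _ _) (hDD _ _)]
  rw [hA]
  unfold Pop
  simp_rw [Dop_Dop_Aop hu, Dop_Aop hu]
  rw [add_sub_add_comm, mul_add]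
  simp_rw [Finset.mul_sum, ← Finset.sum_sub_distrib, coefT]
  congr 1
  · refine Finset.sum_congr rfl fun j _ => Finset.sum_congr rfl fun k _ => ?_
    ring
  · refine Finset.sum_congr rfl fun k _ => ?_
    ring

lemma adA_Pop {d : ℕ} {a : Fin d → Fin d → Euc d → ℂ} {b : Fin d → Euc d → ℂ}
    (ha : ∀ j k, ContDiff ℝ (⊤ : ℕ∞) (a j k)) (hb : ∀ k, ContDiff ℝ (⊤ : ℕ∞) (b k)) (n : ℕ)
    {u : Euc d → ℂ} (hu : ContDiff ℝ (⊤ : ℕ∞) u) :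
    adA n (Pop a b) u = fun x => (-I) ^ n *
      Pop (fun j k => (coefT 2)^[n] (a j k)) (fun k => (coefT 1)^[n] (b k)) u x := by
  induction n generalizing u with
  | zero =>
    funext x
    simp [adA]
  | succ n ih =>
    funext x
    have ha' := fun j k => contDiff_iterate_coefT (ha j k) 2 n
    have hb' := fun k => contDiff_iterate_coefT (hb k) 1 n
    simp only [adA]
    rw [ih hu, ih (contDiff_Aop hu),
      Aop_const_mul ((contDiff_Pop ha' hb' hu).differentiable (by simp)), ← mul_sub,
      Pop_Aop_sub_Aop_Pop ha' hb' hu]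
    simp_rw [Function.iterate_succ_apply']
    ring

/-- For smooth coefficients, `i^n ad_A^n P` is the differential operator with
coefficients `(2 - x·∇)^n a_{jk}` and `(1 - x·∇)^n b_k`. -/
theorem statement4 (d n : ℕ) (hd : 3 ≤ d) (hn : 1 ≤ n)
    (a : Fin d → Fin d → Euc d → ℂ) (b : Fin d → Euc d → ℂ)
    (ha : ∀ j k, ContDiff ℝ (⊤ : ℕ∞) (a j k)) (hb : ∀ k, ContDiff ℝ (⊤ : ℕ∞) (b k)) :
    ∀ (u : SchwartzMap (Euc d) ℂ) (x : Euc d),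
      Complex.I ^ n * adA n (Pop a b) ⇑u x =
        (∑ j : Fin d, ∑ k : Fin d, (coefT 2)^[n] (a j k) x * Dop j (Dop k ⇑u) x) +
          ∑ k : Fin d, (coefT 1)^[n] (b k) x * Dop k ⇑u x := by
  intro u x
  have hI : I ^ n * (-I) ^ n = 1 := by
    rw [← mul_pow]
    simp
  simp only [adA_Pop ha hb n (u.smooth _)]
  rw [← mul_assoc, hI, one_mul]
  rfl
end
end

section
/- Let d ≥ 1. For κ > 0 and ζ ∈ ℂ with Im ζ < 0, define the operator R_κ(ζ) on Schwartz functions by R_κ(ζ)φ := (1/i) ∫₀^∞ e^{−iτζ} U_{κτ} φ dτ (an absolutely convergent Bochner integral in L², since ‖U_{κτ}φ‖_{L²} = ‖φ‖_{L²}). Then there exists a universal constant C > 0 such that for every r ∈ ℝ, every κ > 0, every ζ with Im ζ < 0 and |Im ζ| > κ|r|, and every Schwartz function φ with ‖|ξ|^r φ̂‖_{L²} < ∞: ‖R_κ(ζ)φ‖_{H^r} ≤ (C / (|Im ζ| − κ|r|)) ‖φ‖_{H^r}. -/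
open MeasureTheory Complex Finset
open scoped ENNReal

noncomputable section

open scoped FourierTransform

/-- The `L²`-unitary dilation `U_τ φ(x) = e^{dτ/2} φ(e^τ x)`. -/
def dil {d : ℕ} (τ : ℝ) (φ : Euc d → ℂ) : Euc d → ℂ :=
  fun x => (Real.exp (d * τ / 2) : ℝ) * φ (Real.exp τ • x)

/-- The resolvent `(κA - ζ)^{-1} φ = (1/i) ∫₀^∞ e^{-iτζ} U_{κτ} φ dτ` of the dilation
generator, written pointwise. -/
def resA {d : ℕ} (κ : ℝ) (ζ : ℂ) (φ : Euc d → ℂ) : Euc d → ℂ :=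
  fun x => (1 / Complex.I) *
    ∫ τ in Set.Ioi (0 : ℝ), Complex.exp (-Complex.I * τ * ζ) * dil (κ * τ) φ x

/-- The norm `‖f‖_{H^r} = ‖f‖_{L²} + ‖ |ξ|^r f̂(ξ) ‖_{L²}` for real `r`. -/
def hrNorm {d : ℕ} (r : ℝ) (f : Euc d → ℂ) : ℝ≥0∞ :=
  eLpNorm f 2 volume +
    eLpNorm (fun ξ : Euc d => ((‖ξ‖ ^ r : ℝ) : ℂ) * 𝓕 f ξ) 2 volume

/-- Cauchy–Schwarz for a lower integral against a density. -/
theorem sq_lintegral_mul_le {α : Type*} [MeasurableSpace α] {μ : Measure α} {w g : α → ℝ≥0∞}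
    (hw : Measurable w) (hg : Measurable g) :
    (∫⁻ t, w t * g t ∂μ) ^ 2 ≤ (∫⁻ t, w t ∂μ) * ∫⁻ t, w t * g t ^ 2 ∂μ := by
  have h := ENNReal.lintegral_mul_le_Lp_mul_Lq (μ.withDensity w) Real.HolderConjugate.two_two
    (f := 1) (g := g) measurable_one.aemeasurable hg.aemeasurable
  simp only [one_mul, Pi.one_apply, lintegral_const, ENNReal.rpow_two, one_pow] at h
  rw [lintegral_withDensity_eq_lintegral_mul _ hw hg,
    lintegral_withDensity_eq_lintegral_mul _ hw (hg.pow_const 2),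
    withDensity_apply _ MeasurableSet.univ, Measure.restrict_univ] at h
  calc (∫⁻ t, w t * g t ∂μ) ^ 2
      ≤ ((∫⁻ t, w t ∂μ) ^ (1 / 2 : ℝ) * (∫⁻ t, w t * g t ^ 2 ∂μ) ^ (1 / 2 : ℝ)) ^ 2 :=
        pow_le_pow_left' h 2
    _ = _ := by
        rw [mul_pow, ← ENNReal.rpow_mul_natCast, ← ENNReal.rpow_mul_natCast]
        norm_num

theorem lintegral_exp_neg_mul_Ioi {b : ℝ} (hb : 0 < b) :
    ∫⁻ t in Set.Ioi (0 : ℝ), ENNReal.ofReal (Real.exp (-b * t)) = ENNReal.ofReal (1 / b) := by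
  rw [← ofReal_integral_eq_lintegral_ofReal (integrableOn_exp_mul_Ioi (neg_lt_zero.2 hb) 0)
    (ae_of_all _ fun t => (Real.exp_pos _).le), integral_exp_mul_Ioi (neg_lt_zero.2 hb)]
  simp

theorem lintegral_comp_exp_smul {d : ℕ} {g : Euc d → ℝ≥0∞} (hg : Measurable g) (s : ℝ) :
    ∫⁻ x, g (Real.exp s • x) = ENNReal.ofReal (Real.exp (-(d * s))) * ∫⁻ x, g x := by
  rw [← lintegral_map hg (measurable_const_smul _),
    Measure.map_addHaar_smul volume (Real.exp_ne_zero s), lintegral_smul_measure, smul_eq_mul,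
    finrank_euclideanSpace_fin, abs_of_pos (by positivity), ← Real.exp_nat_mul, ← Real.exp_neg]

/-- Minkowski's inequality for an exponentially weighted superposition of unitary dilations. -/
theorem eLpNorm_two_le_of_enorm_le_lintegral_dil {d : ℕ} {b c : ℝ} (hb : 0 < b)
    {F g : Euc d → ℂ} (hg : Measurable g)
    (hF : ∀ x, ‖F x‖ₑ ≤ ∫⁻ t in Set.Ioi (0 : ℝ),
      ENNReal.ofReal (Real.exp (-b * t)) * ‖dil (c * t) g x‖ₑ) :
    eLpNorm F 2 volume ≤ ENNReal.ofReal (1 / b) * eLpNorm g 2 volume := by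
  have hdil : Measurable fun p : Euc d × ℝ => dil (c * p.2) g p.1 := by
    unfold dil
    exact Measurable.mul (by fun_prop) (hg.comp (by fun_prop))
  have hunit : ∀ t : ℝ, ∫⁻ x, ‖dil t g x‖ₑ ^ 2 = ∫⁻ x, ‖g x‖ₑ ^ 2 := fun t => by
    simp only [dil, enorm_mul, mul_pow]
    rw [lintegral_const_mul _ (by fun_prop),
      lintegral_comp_exp_smul (g := fun x => ‖g x‖ₑ ^ 2) (by fun_prop), ← mul_assoc,
      ← ofReal_norm, Complex.norm_of_nonneg (Real.exp_pos _).le,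
      ← ENNReal.ofReal_pow (Real.exp_pos _).le, ← ENNReal.ofReal_mul (by positivity),
      ← Real.exp_nat_mul, ← Real.exp_add]
    rw [show ((2 : ℕ) : ℝ) * (d * t / 2) + -(d * t) = 0 by push_cast; ring]
    simp
  have key : ∫⁻ x, ‖F x‖ₑ ^ 2 ≤ ENNReal.ofReal (1 / b) ^ 2 * ∫⁻ x, ‖g x‖ₑ ^ 2 := by
    calc ∫⁻ x, ‖F x‖ₑ ^ 2
        ≤ ∫⁻ x, ENNReal.ofReal (1 / b) * ∫⁻ t in Set.Ioi (0 : ℝ),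
            ENNReal.ofReal (Real.exp (-b * t)) * ‖dil (c * t) g x‖ₑ ^ 2 := by
          refine lintegral_mono fun x => ?_
          rw [← lintegral_exp_neg_mul_Ioi hb]
          refine (pow_le_pow_left' (hF x) 2).trans (sq_lintegral_mul_le (by fun_prop) ?_)
          exact (hdil.comp (measurable_prodMk_left (x := x))).enorm
      _ = ENNReal.ofReal (1 / b) * ∫⁻ t in Set.Ioi (0 : ℝ), ∫⁻ x,
            ENNReal.ofReal (Real.exp (-b * t)) * ‖dil (c * t) g x‖ₑ ^ 2 := by
          rw [lintegral_const_mul' _ _ ENNReal.ofReal_ne_top, lintegral_lintegral_swap]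
          exact (Measurable.mul (by fun_prop) (hdil.enorm.pow_const 2)).aemeasurable
      _ = _ := by
          simp_rw [lintegral_const_mul' _ _ ENNReal.ofReal_ne_top, hunit]
          rw [lintegral_mul_const _ (by fun_prop), lintegral_exp_neg_mul_Ioi hb, sq, mul_assoc]
  rw [eLpNorm_eq_lintegral_rpow_enorm_toReal two_ne_zero ENNReal.ofNat_ne_top,
    eLpNorm_eq_lintegral_rpow_enorm_toReal two_ne_zero ENNReal.ofNat_ne_top]
  simp only [ENNReal.toReal_ofNat, ENNReal.rpow_two]
  refine (ENNReal.rpow_le_rpow key (by norm_num)).trans_eq ?_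
  rw [ENNReal.mul_rpow_of_nonneg _ _ (by norm_num), ← ENNReal.rpow_natCast_mul]
  norm_num

theorem norm_cexp_neg_I_mul (t : ℝ) (ζ : ℂ) :
    ‖Complex.exp (-Complex.I * t * ζ)‖ = Real.exp (ζ.im * t) := by
  rw [Complex.norm_exp]
  congr 1
  simp [mul_comm]

/-- The dilation group is intertwined with its inverse by the Fourier transform. -/
theorem fourier_dil {d : ℕ} (s : ℝ) (f : Euc d → ℂ) (ξ : Euc d) :
    𝓕 (dil s f) ξ = dil (-s) (𝓕 f) ξ := by
  have h := Measure.integral_comp_smul (volume : Measure (Euc d))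
    (fun v => 𝐞 (-inner ℝ v (Real.exp (-s) • ξ)) • f v) (Real.exp s)
  have hinner : ∀ v : Euc d,
      inner ℝ (Real.exp s • v) (Real.exp (-s) • ξ) = inner ℝ v ξ := fun v => by
    rw [inner_smul_left, inner_smul_right, ← mul_assoc]
    simp [← Real.exp_add]
  simp only [hinner] at h
  simp only [dil, Real.fourier_eq]
  simp only [Circle.smul_def, smul_eq_mul] at h ⊢
  simp_rw [mul_left_comm _ ((Real.exp (d * s / 2) : ℝ) : ℂ)]
  rw [integral_const_mul, h, finrank_euclideanSpace_fin, abs_of_pos (by positivity),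
    ← Real.exp_nat_mul, ← Real.exp_neg, Complex.real_smul, ← mul_assoc, ← Complex.ofReal_mul,
    ← Real.exp_add]
  congr 4
  ring

theorem integrable_dil {d : ℕ} (s : ℝ) {f : Euc d → ℂ} (hf : Integrable f) :
    Integrable (dil s f) :=
  (hf.comp_smul (Real.exp_ne_zero s)).const_mul _

theorem integral_norm_dil {d : ℕ} (s : ℝ) (f : Euc d → ℂ) :
    ∫ x, ‖dil s f x‖ = Real.exp (-(d * s / 2)) * ∫ x, ‖f x‖ := by
  simp only [dil, norm_mul, Complex.norm_of_nonneg (Real.exp_pos _).le]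
  rw [integral_const_mul, Measure.integral_comp_smul volume (fun x => ‖f x‖),
    finrank_euclideanSpace_fin, abs_of_pos (by positivity), ← Real.exp_nat_mul, ← Real.exp_neg,
    smul_eq_mul, ← mul_assoc, ← Real.exp_add]
  congr 2
  ring

theorem integrable_cexp_mul_dil {d : ℕ} {κ : ℝ} (hκ : 0 < κ) {ζ : ℂ} (hζ : ζ.im < 0)
    {f : Euc d → ℂ} (hm : Measurable f) (hf : Integrable f) :
    Integrable (fun p : Euc d × ℝ => Complex.exp (-Complex.I * p.2 * ζ) * dil (κ * p.2) f p.1)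
      (volume.prod (volume.restrict (Set.Ioi 0))) := by
  have hmeas : Measurable fun p : Euc d × ℝ =>
      Complex.exp (-Complex.I * p.2 * ζ) * dil (κ * p.2) f p.1 := by
    unfold dil
    exact Measurable.mul (by fun_prop) (Measurable.mul (by fun_prop) (hm.comp (by fun_prop)))
  rw [integrable_prod_iff' hmeas.aestronglyMeasurable]
  refine ⟨ae_of_all _ fun t => (integrable_dil (κ * t) hf).const_mul
    (Complex.exp (-Complex.I * t * ζ)), ?_⟩
  have hneg : ζ.im - d * κ / 2 < 0 := by
    have : 0 ≤ d * κ / 2 := by positivity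
    linarith
  refine ((integrableOn_exp_mul_Ioi hneg 0).mul_const (∫ x, ‖f x‖)).congr
    (ae_of_all _ fun t => ?_)
  simp only [norm_mul, norm_cexp_neg_I_mul]
  rw [integral_const_mul, integral_norm_dil, ← mul_assoc, ← Real.exp_add]
  congr 2
  ring

/-- The Fourier transform of the resolvent as a superposition of dilations of `𝓕 f`. -/
theorem fourier_resA {d : ℕ} {κ : ℝ} (hκ : 0 < κ) {ζ : ℂ} (hζ : ζ.im < 0)
    {f : Euc d → ℂ} (hm : Measurable f) (hf : Integrable f) (ξ : Euc d) :
    𝓕 (resA κ ζ f) ξ = (1 / Complex.I) *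
      ∫ t in Set.Ioi (0 : ℝ), Complex.exp (-Complex.I * t * ζ) * dil (-(κ * t)) (𝓕 f) ξ := by
  have hprod := integrable_cexp_mul_dil hκ hζ hm hf
  have hprod_char : Integrable (Function.uncurry fun (v : Euc d) (t : ℝ) =>
      (𝐞 (-inner ℝ v ξ) : ℂ) * (Complex.exp (-Complex.I * t * ζ) * dil (κ * t) f v))
      (volume.prod (volume.restrict (Set.Ioi 0))) := by
    refine hprod.bdd_mul (c := 1) (f := fun p : Euc d × ℝ => (𝐞 (-inner ℝ p.1 ξ) : ℂ)) ?_ ?_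
    · exact Continuous.aestronglyMeasurable (by fun_prop)
    · exact ae_of_all _ fun p => (Circle.norm_coe _).le
  simp_rw [← fourier_dil, Real.fourier_eq, resA, Circle.smul_def, smul_eq_mul]
  simp_rw [mul_left_comm _ (1 / Complex.I)]
  rw [integral_const_mul]
  congr 1
  simp_rw [← integral_const_mul]
  rw [integral_integral_swap hprod_char]
  simp_rw [mul_left_comm _ (Complex.exp _)]

theorem enorm_one_div_I_mul_integral_le {d : ℕ} (ζ : ℂ) (s : ℝ → ℝ) (g : Euc d → ℂ) (x : Euc d) :
    ‖(1 / Complex.I) * ∫ t in Set.Ioi (0 : ℝ),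
        Complex.exp (-Complex.I * t * ζ) * dil (s t) g x‖ₑ ≤
      ∫⁻ t in Set.Ioi (0 : ℝ), ENNReal.ofReal (Real.exp (ζ.im * t)) * ‖dil (s t) g x‖ₑ := by
  rw [enorm_mul, show ‖1 / Complex.I‖ₑ = 1 by simp [← ofReal_norm], one_mul]
  refine (enorm_integral_le_lintegral_enorm _).trans_eq ?_
  simp_rw [enorm_mul, ← ofReal_norm (Complex.exp _), norm_cexp_neg_I_mul]

theorem rpow_norm_mul_dil {d : ℕ} (r s : ℝ) (g : Euc d → ℂ) (ξ : Euc d) :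
    ((‖ξ‖ ^ r : ℝ) : ℂ) * dil s g ξ =
      (Real.exp (-s * r) : ℝ) * dil s (fun η => ((‖η‖ ^ r : ℝ) : ℂ) * g η) ξ := by
  have h : ‖ξ‖ ^ r = Real.exp (-s * r) * ‖Real.exp s • ξ‖ ^ r := by
    rw [norm_smul, Real.norm_of_nonneg (Real.exp_pos s).le,
      Real.mul_rpow (Real.exp_pos s).le (norm_nonneg ξ), ← Real.exp_mul, ← mul_assoc,
      ← Real.exp_add]
    simp
  simp only [dil]
  rw [h]
  push_cast
  ring

/-- `‖(κA - ζ)^{-1} φ‖_{H^r} ≤ C (|Im ζ| - κ|r|)^{-1} ‖φ‖_{H^r}` for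
`Im ζ < 0` with `|Im ζ| > κ|r|` and Schwartz `φ` with `‖|ξ|^r φ̂‖_{L²} < ∞`. -/
theorem statement8 (d : ℕ) (hd : 1 ≤ d) :
    ∃ C : ℝ, 0 < C ∧
      ∀ (r κ : ℝ), 0 < κ → ∀ ζ : ℂ, ζ.im < 0 → κ * |r| < |ζ.im| →
        ∀ φ : SchwartzMap (Euc d) ℂ,
          eLpNorm (fun ξ : Euc d => ((‖ξ‖ ^ r : ℝ) : ℂ) * 𝓕 (⇑φ) ξ) 2 volume < ⊤ →
          hrNorm r (resA κ ζ ⇑φ) ≤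
            ENNReal.ofReal (C / (|ζ.im| - κ * |r|)) * hrNorm r ⇑φ := by
  refine ⟨1, one_pos, fun r κ hκ ζ hζ hlt φ _ => ?_⟩
  have habs : |ζ.im| = -ζ.im := abs_of_neg hζ
  have hb : 0 < |ζ.im| - κ * |r| := sub_pos.2 hlt
  have hκr : 0 ≤ κ * |r| := by positivity
  have hmeas : Measurable (𝓕 (⇑φ)) := by
    rw [← SchwartzMap.fourier_coe]
    exact (𝓕 φ).continuous.measurable
  rw [hrNorm, hrNorm, mul_add]
  refine add_le_add ?_ ?_
  · refine eLpNorm_two_le_of_enorm_le_lintegral_dil (c := κ) hb φ.continuous.measurable fun x =>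
      (enorm_one_div_I_mul_integral_le ζ _ _ x).trans
        (setLIntegral_mono' measurableSet_Ioi fun t ht => ?_)
    have ht : 0 < t := ht
    gcongr
    rw [habs]
    linarith
  · refine eLpNorm_two_le_of_enorm_le_lintegral_dil (c := -κ) hb (by fun_prop) fun ξ => ?_
    rw [fourier_resA hκ hζ φ.continuous.measurable φ.integrable, enorm_mul]
    refine (mul_le_mul_right (enorm_one_div_I_mul_integral_le ζ _ _ ξ) _).trans ?_
    rw [← lintegral_const_mul' _ _ enorm_ne_top]
    refine setLIntegral_mono' measurableSet_Ioi fun t ht => ?_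
    have ht : 0 < t := ht
    rw [mul_left_comm, ← enorm_mul, rpow_norm_mul_dil, enorm_mul, ← mul_assoc, neg_mul κ,
      ← ofReal_norm (Complex.ofReal _), Complex.norm_of_nonneg (Real.exp_pos _).le,
      ← ENNReal.ofReal_mul (Real.exp_pos _).le, ← Real.exp_add]
    gcongr
    rw [habs]
    have : κ * t * r ≤ κ * t * |r| := by gcongr; exact le_abs_self r
    linarith
end
end
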